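/- Let $E\subset\mathbb{R}^n$ be nonempty, $\alpha>0$, and $w(x)=\operatorname{dist}(x,E)^{-\alpha}$. If $w\in A_1$, then $E$ is weakly porous, with weak porosity constants depending only on $n$, $\alpha$ and $[w]_{A_1}$. -/

import Mathlib

open MeasureTheory Metric Set

noncomputable section

/-- An axis-parallel half-open cube in `ℝⁿ`, given by its lower corner and side length. -/
structure Cube (n : ℕ) where
  a : EuclideanSpace ℝ (Fin n)
  l : ℝ
  pos : 0 < l

/-- The set of points of a cube. -/
def Cube.set {n : ℕ} (P : Cube n) : Set (EuclideanSpace ℝ (Fin n)) :=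
  {x | ∀ i, P.a i ≤ x i ∧ x i < P.a i + P.l}

/-- A weight: locally integrable and a.e. positive. -/
def IsWeight {n : ℕ} (w : EuclideanSpace ℝ (Fin n) → ℝ) : Prop :=
  LocallyIntegrable w volume ∧ ∀ᵐ x ∂(volume : Measure (EuclideanSpace ℝ (Fin n))), 0 < w x

/-- The `A₁` inequality with constant `C`, over all axis-parallel cubes. -/
def A1With {n : ℕ} (w : EuclideanSpace ℝ (Fin n) → ℝ) (C : ℝ) : Prop :=
  ∀ P : Cube n, (⨍ x in P.set, w x) ≤ C * essInf w (volume.restrict P.set)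

/-- Membership in the Muckenhoupt class `A₁`. -/
def MemA1 {n : ℕ} (w : EuclideanSpace ℝ (Fin n) → ℝ) : Prop :=
  IsWeight w ∧ ∃ C : ℝ, A1With w C

/-- The `A_p` inequality with constant `C`, over all axis-parallel cubes. -/
def ApWith {n : ℕ} (w : EuclideanSpace ℝ (Fin n) → ℝ) (p C : ℝ) : Prop :=
  ∀ P : Cube n,
    (⨍ x in P.set, w x) * (⨍ x in P.set, w x ^ (1 / (1 - p))) ^ (p - 1) ≤ C

/-- Membership in the Muckenhoupt class `A_p`. -/
def MemAp {n : ℕ} (w : EuclideanSpace ℝ (Fin n) → ℝ) (p : ℝ) : Prop :=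
  IsWeight w ∧ ∃ C : ℝ, ApWith w p C

/-- `Q` is a dyadic subcube of `P`. -/
def IsDyadicSubcube {n : ℕ} (P Q : Cube n) : Prop :=
  ∃ (j : ℕ) (k : Fin n → ℕ), (∀ i, k i < 2 ^ j) ∧
    Q.l = P.l / 2 ^ j ∧ ∀ i, Q.a i = P.a i + P.l * k i / 2 ^ j

/-- A cube is `E`-free if it does not meet `E`. -/
def EFree {n : ℕ} (E : Set (EuclideanSpace ℝ (Fin n))) (Q : Cube n) : Prop :=
  Q.set ∩ E = ∅

/-- The measure `|𝓜(P)|` of a largest `E`-free dyadic subcube of `P`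
(`0` if there is none). -/
def maxFree {n : ℕ} (E : Set (EuclideanSpace ℝ (Fin n))) (P : Cube n) : ℝ :=
  sSup {v : ℝ | ∃ Q : Cube n, IsDyadicSubcube P Q ∧ EFree E Q ∧ v = (volume Q.set).toReal}

/-- Weak porosity with constants `c`, `δ`. -/
def WeaklyPorousWith {n : ℕ} (E : Set (EuclideanSpace ℝ (Fin n))) (c δ : ℝ) : Prop :=
  ∀ P : Cube n, ∃ (N : ℕ) (Q : Fin N → Cube n),
    (∀ k, IsDyadicSubcube P (Q k) ∧ EFree E (Q k)) ∧
    (∀ k m, k ≠ m → Disjoint (Q k).set (Q m).set) ∧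
    (∀ k, δ * maxFree E P ≤ (volume (Q k).set).toReal) ∧
    c * (volume P.set).toReal ≤ ∑ k, (volume (Q k).set).toReal

/-- A set is weakly porous if it is weakly porous with some constants `0 < c, δ < 1`. -/
def WeaklyPorous {n : ℕ} (E : Set (EuclideanSpace ℝ (Fin n))) : Prop :=
  ∃ c δ : ℝ, 0 < c ∧ c < 1 ∧ 0 < δ ∧ δ < 1 ∧ WeaklyPorousWith E c δ

/-- Porosity. -/
def Porous {n : ℕ} (E : Set (EuclideanSpace ℝ (Fin n))) : Prop :=
  ∃ c : ℝ, 0 < c ∧ ∀ (x : EuclideanSpace ℝ (Fin n)) (r : ℝ), 0 < r →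
    ∃ y : EuclideanSpace ℝ (Fin n), ball y (c * r) ⊆ ball x r \ E

/-- The distance weight `dist(·,E)^{-α}`. -/
def distw {n : ℕ} (E : Set (EuclideanSpace ℝ (Fin n))) (α : ℝ)
    (x : EuclideanSpace ℝ (Fin n)) : ℝ :=
  infDist x E ^ (-α)

/-- `h_E(B(x,R))`: the supremum of radii `t` of balls contained in `B(x,R) \ E`. -/
def hFree {n : ℕ} (E : Set (EuclideanSpace ℝ (Fin n))) (x : EuclideanSpace ℝ (Fin n))
    (R : ℝ) : ℝ :=
  sSup {t : ℝ | ∃ y ∈ ball x R, ball y t ⊆ ball x R \ E}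

/-- The set of admissible exponents in the definition of the Muckenhoupt exponent. -/
def MuckSet {n : ℕ} (E : Set (EuclideanSpace ℝ (Fin n))) : Set ℝ :=
  {α : ℝ | ∃ C : ℝ, ∀ x ∈ E, ∀ R r : ℝ, 0 < r → r < hFree E x R → hFree E x R ≤ R →
    (volume (thickening r E ∩ ball x R)).toReal ≤
      C * (hFree E x R / r) ^ (-α) * (volume (ball x R)).toReal}

open scoped Classical in
/-- The Muckenhoupt exponent of `E`. -/
def MuckExp {n : ℕ} (E : Set (EuclideanSpace ℝ (Fin n))) : ℝ :=
  if ∀ x ∈ E, ∀ R : ℝ, 0 < R → 0 < hFree E x R then sSup (MuckSet E) else 0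

end

section Cubes

variable {n : ℕ}

theorem Cube.set_eq_preimage (P : Cube n) :
    P.set = WithLp.ofLp ⁻¹' (univ.pi fun i => Ico (P.a i) (P.a i + P.l)) := by
  ext x
  simp [Cube.set]

theorem Cube.measurableSet (P : Cube n) : MeasurableSet P.set := by
  rw [P.set_eq_preimage]
  exact (PiLp.volume_preserving_ofLp (Fin n)).measurable
    (MeasurableSet.univ_pi fun _ => measurableSet_Ico)

theorem Cube.volume_set (P : Cube n) : volume P.set = ENNReal.ofReal P.l ^ n := by
  rw [P.set_eq_preimage, (PiLp.volume_preserving_ofLp (Fin n)).measure_preimage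
    (MeasurableSet.univ_pi fun _ => measurableSet_Ico).nullMeasurableSet, Real.volume_pi_Ico]
  simp

theorem Cube.volume_set_toReal (P : Cube n) : (volume P.set).toReal = P.l ^ n := by
  rw [P.volume_set, ENNReal.toReal_pow, ENNReal.toReal_ofReal P.pos.le]

theorem Cube.volume_set_ne_top (P : Cube n) : volume P.set ≠ ⊤ := by
  simp [P.volume_set]

theorem Cube.dist_le (P : Cube n) {x y : EuclideanSpace ℝ (Fin n)} (hx : x ∈ P.set)
    (hy : y ∈ P.set) : dist x y ≤ (n + 1) * P.l := by
  have hl := P.pos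
  refine abs_le_of_sq_le_sq' ?_ (by positivity) |>.2
  rw [EuclideanSpace.dist_sq_eq]
  calc ∑ i, dist (x i) (y i) ^ 2 ≤ ∑ _i : Fin n, P.l ^ 2 := by
        refine Finset.sum_le_sum fun i _ => pow_le_pow_left₀ dist_nonneg ?_ 2
        rw [Real.dist_eq, abs_le]
        constructor <;> linarith [(hx i).1, (hx i).2, (hy i).1, (hy i).2]
    _ = n * P.l ^ 2 := by simp
    _ ≤ ((n + 1) * P.l) ^ 2 := by
        rw [mul_pow]
        gcongr
        nlinarith [n.cast_nonneg (α := ℝ)]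

theorem Cube.isBounded (P : Cube n) : Bornology.IsBounded P.set :=
  Metric.isBounded_iff.2 ⟨_, fun _ hx _ hy => P.dist_le hx hy⟩

/-- The center of a cube. -/
noncomputable def Cube.center (P : Cube n) : EuclideanSpace ℝ (Fin n) :=
  WithLp.toLp 2 fun i => P.a i + P.l / 2

theorem Cube.ball_center_subset (P : Cube n) : ball P.center (P.l / 2) ⊆ P.set := by
  intro x hx i
  have h := (PiLp.norm_apply_le (x - P.center) i).trans_lt (mem_ball_iff_norm.1 hx)
  rw [Real.norm_eq_abs, abs_lt] at h
  simp only [PiLp.sub_apply, Cube.center] at h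
  constructor <;> linarith [h.1, h.2]

/-- The dyadic subcube of `P` of level `j` with multi-index `k`. -/
noncomputable def Cube.dyadic (P : Cube n) (j : ℕ) (k : Fin n → Fin (2 ^ j)) : Cube n where
  a := WithLp.toLp 2 fun i => P.a i + P.l * (k i : ℕ) / 2 ^ j
  l := P.l / 2 ^ j
  pos := by have := P.pos; positivity

theorem Cube.isDyadicSubcube_dyadic (P : Cube n) (j : ℕ) (k : Fin n → Fin (2 ^ j)) :
    IsDyadicSubcube P (P.dyadic j k) :=
  ⟨j, fun i => k i, fun i => (k i).2, rfl, fun _ => rfl⟩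

theorem IsDyadicSubcube.subset {P Q : Cube n} (h : IsDyadicSubcube P Q) : Q.set ⊆ P.set := by
  obtain ⟨j, k, hk, hl, ha⟩ := h
  intro x hx i
  have hP := P.pos
  obtain ⟨h1, h2⟩ := hx i
  rw [ha i] at h1 h2
  rw [hl] at h2
  have h3 : (k i : ℝ) + 1 ≤ 2 ^ j := by exact_mod_cast hk i
  have h4 : P.l * k i / 2 ^ j + P.l / 2 ^ j ≤ P.l := by
    rw [← add_div, div_le_iff₀ (by positivity)]
    nlinarith
  have h5 : 0 ≤ P.l * k i / 2 ^ j := by positivity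
  constructor <;> linarith

theorem Cube.mem_dyadic_iff (P : Cube n) (j : ℕ) (k : Fin n → Fin (2 ^ j))
    (x : EuclideanSpace ℝ (Fin n)) :
    x ∈ (P.dyadic j k).set ↔ ∀ i, ⌊(x i - P.a i) / (P.l / 2 ^ j)⌋ = ((k i : ℕ) : ℤ) := by
  have hP : 0 < P.l / 2 ^ j := by have := P.pos; positivity
  refine forall_congr' fun i => ?_
  rw [Int.floor_eq_iff, le_div_iff₀ hP, div_lt_iff₀ hP]
  have : ((k i : ℕ) : ℝ) * (P.l / 2 ^ j) = P.l * (k i : ℕ) / 2 ^ j := by ring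
  simp only [Cube.dyadic, Int.cast_natCast, add_mul, one_mul, this]
  constructor <;> rintro ⟨h1, h2⟩ <;> constructor <;> linarith

theorem Cube.pairwise_disjoint_dyadic (P : Cube n) (j : ℕ) :
    Pairwise fun k m => Disjoint (P.dyadic j k).set (P.dyadic j m).set := by
  intro k m hkm
  refine Set.disjoint_left.2 fun x hk hm => hkm ?_
  rw [P.mem_dyadic_iff] at hk hm
  ext i
  exact_mod_cast (hk i).symm.trans (hm i)

theorem Cube.exists_mem_dyadic (P : Cube n) (j : ℕ) {x : EuclideanSpace ℝ (Fin n)}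
    (hx : x ∈ P.set) : ∃ k, x ∈ (P.dyadic j k).set := by
  have hP := P.pos
  have hs : 0 < P.l / 2 ^ j := by positivity
  have h0 (i) : 0 ≤ (x i - P.a i) / (P.l / 2 ^ j) :=
    div_nonneg (sub_nonneg.2 (hx i).1) hs.le
  refine ⟨fun i => ⟨⌊(x i - P.a i) / (P.l / 2 ^ j)⌋₊, ?_⟩, ?_⟩
  · rw [Nat.floor_lt (h0 i), div_lt_iff₀ hs]
    push_cast
    rw [mul_div_cancel₀ _ (by positivity)]
    linarith [(hx i).2]
  · rw [P.mem_dyadic_iff]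
    exact fun i => (Int.natCast_floor_eq_floor (h0 i)).symm

end Cubes

section DistanceWeight

variable {n : ℕ} {E : Set (EuclideanSpace ℝ (Fin n))} {α C : ℝ}

theorem distw_nonneg (x : EuclideanSpace ℝ (Fin n)) : 0 ≤ distw E α x :=
  Real.rpow_nonneg infDist_nonneg _

theorem essInf_distw_nonneg (μ : Measure (EuclideanSpace ℝ (Fin n))) :
    0 ≤ essInf (distw E α) μ := by
  have h : ∀ᵐ x ∂μ, 0 ≤ distw E α x := Filter.Eventually.of_forall distw_nonneg
  exact Real.sSup_nonneg' ⟨0, h, le_rfl⟩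

theorem IsWeight.ae_infDist_pos (hw : IsWeight (distw E α)) (hα : 0 < α) :
    ∀ᵐ x ∂(volume : Measure (EuclideanSpace ℝ (Fin n))), 0 < infDist x E := by
  filter_upwards [hw.2] with x hx
  refine infDist_nonneg.lt_of_ne fun h => hx.ne' ?_
  rw [distw, ← h, Real.zero_rpow (neg_ne_zero.2 hα.ne')]

theorem IsWeight.integrableOn_cube {w : EuclideanSpace ℝ (Fin n) → ℝ} (hw : IsWeight w)
    (P : Cube n) : IntegrableOn w P.set :=
  (hw.1.integrableOn_isCompact P.isBounded.isCompact_closure).mono_set subset_closure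

/-- If the complement of `E` has full measure, then every cube has an `E`-free dyadic subcube. -/
theorem exists_eFree_dyadic
    (hE : ∀ᵐ x ∂(volume : Measure (EuclideanSpace ℝ (Fin n))), 0 < infDist x E) (P : Cube n) :
    ∃ j k, EFree E (P.dyadic j k) := by
  have hP := P.pos
  have hball : volume (ball P.center (P.l / 2)) ≠ 0 :=
    (measure_ball_pos volume _ (by positivity)).ne'
  obtain ⟨x, hx, hxE⟩ : ∃ x ∈ ball P.center (P.l / 2), 0 < infDist x E := by
    by_contra! h
    exact hball (measure_mono_null (fun x hx => not_lt.2 (h x hx)) hE)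
  obtain ⟨j, hj⟩ := pow_unbounded_of_one_lt ((n + 1) * P.l / infDist x E) one_lt_two
  obtain ⟨k, hk⟩ := P.exists_mem_dyadic j (P.ball_center_subset hx)
  refine ⟨j, k, Set.eq_empty_of_forall_notMem fun y ⟨hy, hyE⟩ => ?_⟩
  have h := (infDist_le_dist_of_mem hyE).trans ((P.dyadic j k).dist_le hk hy)
  rw [div_lt_iff₀ hxE, ← div_lt_iff₀' (by positivity), mul_div_assoc] at hj
  exact hj.not_ge h

/-- An `E`-free cube inside `P` bounds the essential infimum of the weight over `P`. -/
theorem essInf_distw_le (hE : E.Nonempty) (hα : 0 < α) {P Q : Cube n} (hQ : Q.set ⊆ P.set)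
    (hfree : EFree E Q) :
    essInf (distw E α) (volume.restrict P.set) ≤ (Q.l / 4) ^ (-α) := by
  have hl := Q.pos
  have hae := ae_essInf_le (f := distw E α) (μ := volume.restrict P.set)
    (Filter.isBoundedUnder_of ⟨0, distw_nonneg⟩)
  rw [ae_restrict_iff' P.measurableSet] at hae
  have hball : volume (ball Q.center (Q.l / 4)) ≠ 0 :=
    (measure_ball_pos volume _ (by positivity)).ne'
  obtain ⟨x, hx, hxP⟩ : ∃ x ∈ ball Q.center (Q.l / 4),
      x ∈ P.set → essInf (distw E α) (volume.restrict P.set) ≤ distw E α x := by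
    by_contra! h
    refine hball (measure_mono_null (fun x hx => ?_) hae)
    exact fun hx' => (h x hx).2.not_ge (hx' (h x hx).1)
  have hsub := Q.ball_center_subset
  refine (hxP (hQ (hsub (ball_subset_ball (by linarith) hx)))).trans ?_
  refine Real.rpow_le_rpow_of_nonpos (by positivity) ?_ (neg_nonpos.2 hα.le)
  refine (le_infDist hE).2 fun y hy => ?_
  by_contra! hxy
  refine Set.eq_empty_iff_forall_notMem.1 hfree y ⟨hsub ?_, hy⟩
  rw [mem_ball] at hx ⊢
  linarith [dist_triangle y x Q.center, dist_comm x y]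

/-- The `A₁` inequality and an `E`-free cube inside `P` bound the integral of the weight. -/
theorem A1With.setIntegral_le (hE : E.Nonempty) (hα : 0 < α) (hA : A1With (distw E α) C)
    {P Q : Cube n} (hQ : Q.set ⊆ P.set) (hfree : EFree E Q) :
    ∫ x in P.set, distw E α x ≤ |C| * (Q.l / 4) ^ (-α) * P.l ^ n := by
  have hl := P.pos
  have h := hA P
  have hess := essInf_distw_le hE hα hQ hfree
  have h0 : 0 ≤ essInf (distw E α) (volume.restrict P.set) :=
    essInf_distw_nonneg _
  rw [setAverage_eq, Measure.real, P.volume_set_toReal, smul_eq_mul,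
    inv_mul_le_iff₀ (by positivity)] at h
  calc _ ≤ _ := h
    _ ≤ P.l ^ n * (|C| * (Q.l / 4) ^ (-α)) := by
        refine mul_le_mul_of_nonneg_left ?_ (by positivity)
        exact (mul_le_mul_of_nonneg_right (le_abs_self C) h0).trans (by gcongr)
    _ = _ := by ring

end DistanceWeight

section Counting

open scoped Classical in
/-- The number of dyadic subcubes of level `j` meeting `E`, bounded through the integral of the
distance weight. -/
theorem card_not_eFree_mul_le {n : ℕ} {E : Set (EuclideanSpace ℝ (Fin n))} {α : ℝ}
    (hα : 0 < α) (hw : IsWeight (distw E α)) (P : Cube n) (j : ℕ) :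
    ((Finset.univ.filter fun k => ¬ EFree E (P.dyadic j k)).card : ℝ) *
      ((P.l / 2 ^ j) ^ n * ((n + 1) * (P.l / 2 ^ j)) ^ (-α)) ≤ ∫ x in P.set, distw E α x := by
  have hP := P.pos
  set B := Finset.univ.filter fun k => ¬ EFree E (P.dyadic j k)
  have hsub (k) : (P.dyadic j k).set ⊆ P.set := (P.isDyadicSubcube_dyadic j k).subset
  have hint := hw.integrableOn_cube P
  have hB (k) (hk : k ∈ B) : (P.l / 2 ^ j) ^ n * ((n + 1) * (P.l / 2 ^ j)) ^ (-α) ≤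
      ∫ x in (P.dyadic j k).set, distw E α x := by
    obtain ⟨y, hy, hyE⟩ := Set.nonempty_iff_ne_empty.2 (Finset.mem_filter.1 hk).2
    have hconst : ∫ _x in (P.dyadic j k).set, ((n + 1) * (P.l / 2 ^ j)) ^ (-α) =
        (P.l / 2 ^ j) ^ n * ((n + 1) * (P.l / 2 ^ j)) ^ (-α) := by
      rw [setIntegral_const, Measure.real, Cube.volume_set_toReal, smul_eq_mul]
      rfl
    rw [← hconst]
    refine setIntegral_mono_on_ae (integrableOn_const (Cube.volume_set_ne_top _))
      (hint.mono_set (hsub k)) (Cube.measurableSet _) ?_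
    filter_upwards [hw.ae_infDist_pos hα] with x hx hxQ
    exact Real.rpow_le_rpow_of_nonpos hx
      ((infDist_le_dist_of_mem hyE).trans ((P.dyadic j k).dist_le hxQ hy)) (neg_nonpos.2 hα.le)
  calc _ = ∑ _k ∈ B, (P.l / 2 ^ j) ^ n * ((n + 1) * (P.l / 2 ^ j)) ^ (-α) := by
        rw [Finset.sum_const, nsmul_eq_mul]
    _ ≤ ∑ k ∈ B, ∫ x in (P.dyadic j k).set, distw E α x := Finset.sum_le_sum hB
    _ = ∫ x in ⋃ k ∈ B, (P.dyadic j k).set, distw E α x :=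
        (integral_biUnion_finset B (fun _ _ => Cube.measurableSet _)
          ((P.pairwise_disjoint_dyadic j).set_pairwise _)
          fun k _ => hint.mono_set (hsub k)).symm
    _ ≤ ∫ x in P.set, distw E α x :=
        setIntegral_mono_set hint (Filter.Eventually.of_forall distw_nonneg)
          (Set.iUnion₂_subset fun k _ => hsub k).eventuallyLE

end Counting

/-- If `dist(·,E)^{-α} ∈ A₁` with constant `C`, then `E` is weakly porous,
with constants depending only on `n`, `α` and the `A₁` constant. -/
theorem a1_implies_weaklyPorous (n : ℕ) (α C : ℝ) (hα : 0 < α) :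
    ∃ c δ : ℝ, 0 < c ∧ c < 1 ∧ 0 < δ ∧ δ < 1 ∧
      ∀ E : Set (EuclideanSpace ℝ (Fin n)), E.Nonempty →
        IsWeight (distw E α) → A1With (distw E α) C →
        WeaklyPorousWith E c δ := by
  have hlim : Filter.Tendsto (fun m : ℕ => |C| * (4 * (n + 1) / 2 ^ m : ℝ) ^ α) Filter.atTop
      (nhds 0) := by
    have h1 : Filter.Tendsto (fun m : ℕ => (4 * (n + 1) / 2 ^ m : ℝ)) Filter.atTop (nhds 0) :=
      tendsto_const_nhds.div_atTop (tendsto_pow_atTop_atTop_of_one_lt one_lt_two)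
    simpa [Real.zero_rpow hα.ne'] using (h1.rpow_const (Or.inr hα.le)).const_mul |C|
  obtain ⟨m, hm⟩ := (hlim.eventually_le_const (show (0 : ℝ) < 1 / 2 by norm_num)).exists
  refine ⟨1 / 2, (1 / 2 ^ m) ^ n / 2, by norm_num, by norm_num, by positivity, ?_, ?_⟩
  · have : ((1 : ℝ) / 2 ^ m) ^ n ≤ 1 :=
      pow_le_one₀ (by positivity) (div_le_one_of_le₀ (one_le_pow₀ one_le_two) (by positivity))
    linarith
  intro E hE hw hA P
  classical
  have hP := P.pos
  have hex := exists_eFree_dyadic (hw.ae_infDist_pos hα) P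
  set j := Nat.find hex
  obtain ⟨k₀, hk₀⟩ := Nat.find_spec hex
  have hmax : maxFree E P ≤ (P.l / 2 ^ j) ^ n := by
    refine Real.sSup_le ?_ (by positivity)
    rintro v ⟨Q, ⟨i, k, hk, hl, ha⟩, hfree, rfl⟩
    have hQ : Q = P.dyadic i fun t => ⟨k t, hk t⟩ := by
      cases Q
      simp only [Cube.dyadic, Cube.mk.injEq]
      exact ⟨PiLp.ext ha, hl⟩
    have hji : j ≤ i := Nat.find_min' hex ⟨_, hQ ▸ hfree⟩
    rw [Q.volume_set_toReal, hl]
    gcongr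
    norm_num
  set s := P.l / 2 ^ (j + m) with hs
  have hs0 : 0 < s := by positivity
  have hjs : P.l / 2 ^ j = s * 2 ^ m := by
    rw [hs, pow_add]
    field_simp
  set G := Finset.univ.filter fun k => EFree E (P.dyadic (j + m) k)
  set B := Finset.univ.filter fun k => ¬ EFree E (P.dyadic (j + m) k)
  have hvol (k) : (volume (P.dyadic (j + m) k).set).toReal = s ^ n := Cube.volume_set_toReal _
  have hcard : (G.card + B.card : ℝ) * s ^ n = P.l ^ n := by
    have h : G.card + B.card = (2 ^ (j + m)) ^ n := by
      rw [Finset.card_filter_add_card_filter_not]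
      simp
    have h' : (G.card + B.card : ℝ) = (2 ^ (j + m)) ^ n := by exact_mod_cast h
    rw [h', ← mul_pow, hs, mul_div_cancel₀ _ (by positivity)]
  have hbad : B.card * s ^ n ≤ P.l ^ n / 2 := by
    have h := (card_not_eFree_mul_le hα hw P (j + m)).trans
      (hA.setIntegral_le hE hα (P.isDyadicSubcube_dyadic j k₀).subset hk₀)
    have hl : (P.dyadic j k₀).l = s * 2 ^ m := hjs
    rw [hl, ← hs, Real.rpow_neg (by positivity), Real.rpow_neg (by positivity), ← mul_assoc,
      ← div_eq_mul_inv, div_le_iff₀ (by positivity)] at h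
    have hratio : ((n + 1) * s) ^ α = (4 * (n + 1) / 2 ^ m) ^ α * (s * 2 ^ m / 4) ^ α := by
      rw [← Real.mul_rpow (by positivity) (by positivity)]
      congr 1
      field_simp
    calc _ ≤ _ := h
      _ = |C| * (4 * (n + 1) / 2 ^ m) ^ α * P.l ^ n := by
          rw [hratio]
          have : (s * 2 ^ m / 4) ^ α ≠ 0 := by positivity
          field_simp
      _ ≤ 1 / 2 * P.l ^ n := by gcongr
      _ = _ := by ring
  refine ⟨G.card, fun t => P.dyadic (j + m) (G.equivFin.symm t), fun t =>
    ⟨P.isDyadicSubcube_dyadic _ _, (Finset.mem_filter.1 (G.equivFin.symm t).2).2⟩,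
    fun t u htu => P.pairwise_disjoint_dyadic _ fun h => htu ?_, fun t => ?_, ?_⟩
  · exact G.equivFin.symm.injective (Subtype.ext h)
  · rw [hvol]
    calc _ ≤ (1 / 2 ^ m) ^ n / 2 * (P.l / 2 ^ j) ^ n := by gcongr
      _ = s ^ n / 2 := by
          rw [hjs, div_mul_eq_mul_div, ← mul_pow]
          congr 2
          field_simp
      _ ≤ s ^ n := half_le_self (by positivity)
  · simp only [hvol, Finset.sum_const, Finset.card_univ, Fintype.card_fin, nsmul_eq_mul,
      P.volume_set_toReal]
    linarith
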